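/- Assume (H1) and (H2). Let τ₀ ≥ 0 and ω₀ < τ₀, and suppose x̄ ∈ A_{ω₀,0} ∩ Γ_{τ₀}. Then there exists L ∈ ℝ such that for every 0 < λ < 1, g(x;u) → L as x → x̄ with x ∈ Q_λ(x̄). Moreover, for each 0 < β < (τ₀ − ω₀)/p there exists δ_β > 0 such that for every 0 < λ < 1 one has |L − g(x;u)| ≤ C · M_{τ₀}(x̄)^{1/p} · ‖x̄ − x‖^β for all x ∈ Q_{λ,δ_β}(x̄), where C := c · ε_{λ′}^{−(n+p)/p} · η₀^{−β} · (1 − η₀^β)^{−1} with λ′ := η₀² · min{λ₀, λ} and c a constant depending only on n, t, p, C_Γ and δ_Γ. -/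

import Mathlib

open MeasureTheory Metric Set Filter
open scoped ENNReal NNReal Topology

noncomputable section

abbrev Euc (n : ℕ) := EuclideanSpace ℝ (Fin n)

variable {n : ℕ}

/-- Distance to the boundary of `Ω`. -/
def dB (Ω : Set (Euc n)) (x : Euc n) : ℝ := infDist x (frontier Ω)

/-- `Ψ(x) = B(x, d(x)/2)`. -/
def PsiB (Ω : Set (Euc n)) (x : Euc n) : Set (Euc n) := ball x (dB Ω x / 2)

/-- `Φ(x) = B(x, d(x)/6)`. -/
def PhiB (Ω : Set (Euc n)) (x : Euc n) : Set (Euc n) := ball x (dB Ω x / 6)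

/-- The integrand of `ν(·;u)`. -/
def nuInt (Ω : Set (Euc n)) (s : Euc n → ℝ) (p : ℝ) (u : Euc n → ℝ) (x : Euc n) : ℝ :=
  (⨍ y in PsiB Ω x, |u y - u x|) ^ p * dB Ω x ^ (-(p * s x))

/-- `ν(E;u)`. -/
def nuM (Ω : Set (Euc n)) (s : Euc n → ℝ) (p : ℝ) (u : Euc n → ℝ) (E : Set (Euc n)) : ℝ :=
  ∫ x in Ω ∩ E, nuInt Ω s p u x

/-- Membership in the nonlocal space `𝒩^{s,p}(Ω)`: `u ∈ L¹(Ω)` and `ν(Ω;u) < ∞`. -/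
def MemN (Ω : Set (Euc n)) (s : Euc n → ℝ) (p : ℝ) (u : Euc n → ℝ) : Prop :=
  IntegrableOn u Ω volume ∧ IntegrableOn (nuInt Ω s p u) Ω volume

/-- `g(x;u)`, the mean of `u` over `Φ(x)`. -/
def gFun (Ω : Set (Euc n)) (u : Euc n → ℝ) (x : Euc n) : ℝ := ⨍ y in PhiB Ω x, u y

/-- The approach region `Q^θ_λ(xb)`. -/
def Qreg (Ω : Set (Euc n)) (lam θ : ℝ) (xb : Euc n) : Set (Euc n) :=
  {x | x ∈ Ω ∧ (lam * dist xb x) ^ θ < dB Ω x}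

/-- `Q` is an `(η,θ)`-corkscrew region for `xb` with radius `δ₀`. -/
def IsCorkscrew (Ω Q : Set (Euc n)) (xb : Euc n) (η θ δ₀ : ℝ) : Prop :=
  ∀ δ : ℝ, 0 < δ → δ ≤ δ₀ →
    ∃ x ∈ Q, η * δ < dist xb x ∧ dist xb x < δ ∧ (η * δ) ^ θ < dB Ω x

/-- `E` is `(C,θ)`-connected to `xb`, with radius `ρ₀` and gauge `ε`. -/
def ConnectedTo (Ω E : Set (Euc n)) (xb : Euc n) (C θ ρ₀ : ℝ) (ε : ℝ → ℝ) : Prop :=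
  ∀ lam : ℝ, 0 < lam → lam < 1 →
    0 < ε lam ∧ ε lam ≤ lam ∧
      ∀ ρ : ℝ, 0 < ρ → ρ ≤ ρ₀ → ∀ x ∈ E ∩ ball xb ρ, ∀ x' ∈ E ∩ ball xb ρ,
        (lam * ρ) ^ θ ≤ dB Ω x → (lam * ρ) ^ θ ≤ dB Ω x' →
        ∃ γ : ℝ → Euc n, ContinuousOn γ (Icc 0 1) ∧ γ 0 = x ∧ γ 1 = x' ∧
          (∀ τ ∈ Icc (0:ℝ) 1, γ τ ∈ E ∧ ε lam * ρ ^ θ ≤ dB Ω (γ τ)) ∧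
          eVariationOn γ (Icc 0 1) ≤ ENNReal.ofReal (C * ρ)

/-- The piecewise bilinear function `α(s,θ)`. -/
def alphaFun (n : ℕ) (p sv θ : ℝ) : ℝ :=
  if p * sv - n ≤ p - 1 then p * (1 - θ) + (p * sv - n) * θ
  else (1 - θ) + (p * sv - n)

/-- `s̲_δ(xb)`. -/
def sLow (Ω : Set (Euc n)) (s : Euc n → ℝ) (xb : Euc n) (δ : ℝ) : ℝ :=
  sInf (s '' (Ω ∩ ball xb δ))

/-- `α̲_δ(xb)`. -/
def alphaLow (Ω : Set (Euc n)) (s : Euc n → ℝ) (p : ℝ) (θΓ : Euc n → ℝ)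
    (xb : Euc n) (δ : ℝ) : ℝ :=
  alphaFun n p (sLow Ω s xb δ) (θΓ xb)

/-- `α̲_0(xb) = lim_{δ → 0⁺} α̲_δ(xb)`. -/
def alphaLow0 (Ω : Set (Euc n)) (s : Euc n → ℝ) (p : ℝ) (θΓ : Euc n → ℝ) (xb : Euc n) : ℝ :=
  limUnder (𝓝[>] (0:ℝ)) (fun δ => alphaLow Ω s p θΓ xb δ)

/-- `Γ_τ`: points of `Γ` where `limsup_{ρ→0⁺} ρ^{-τ} ν(B(xb,ρ);u) < ∞`. -/
def GammaTau (Ω : Set (Euc n)) (s : Euc n → ℝ) (p : ℝ) (u : Euc n → ℝ)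
    (Γ : Set (Euc n)) (τ : ℝ) : Set (Euc n) :=
  {xb ∈ Γ | ∃ M : ℝ, ∀ᶠ ρ in 𝓝[>] (0:ℝ), ρ ^ (-τ) * nuM Ω s p u (ball xb ρ) ≤ M}

/-- `M_τ(xb) = sup_{0<ρ≤δΓ} ρ^{-τ} ν(B(xb,ρ);u)`. -/
def Mtau (Ω : Set (Euc n)) (s : Euc n → ℝ) (p : ℝ) (u : Euc n → ℝ)
    (δΓ τ : ℝ) (xb : Euc n) : ℝ :=
  sSup ((fun ρ => ρ ^ (-τ) * nuM Ω s p u (ball xb ρ)) '' Ioc 0 δΓ)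

lemma dB_nonneg (Ω : Set (Euc n)) (x : Euc n) : 0 ≤ dB Ω x := infDist_nonneg

lemma dB_pos {Ω : Set (Euc n)} (hΩ : IsOpen Ω) (hf : (frontier Ω).Nonempty) {x : Euc n}
    (hx : x ∈ Ω) : 0 < dB Ω x := by
  refine (isClosed_frontier.notMem_iff_infDist_pos hf).1 ?_
  intro h
  rw [hΩ.frontier_eq] at h
  exact h.2 hx

lemma dB_le_add (Ω : Set (Euc n)) (x y : Euc n) : dB Ω x ≤ dB Ω y + dist x y :=
  infDist_le_infDist_add_dist

lemma dB_le_dist {Ω : Set (Euc n)} {xb : Euc n} (hxb : xb ∈ frontier Ω) (x : Euc n) :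
    dB Ω x ≤ dist x xb := infDist_le_dist_of_mem hxb

lemma ball_dB_subset {Ω : Set (Euc n)} (hΩ : IsOpen Ω) (hf : (frontier Ω).Nonempty) {x : Euc n}
    (hx : x ∈ Ω) : ball x (dB Ω x) ⊆ Ω := by
  refine (convex_ball x (dB Ω x)).isPreconnected.subset_of_closure_inter_subset hΩ
    ⟨x, mem_ball_self (dB_pos hΩ hf hx), hx⟩ ?_
  rintro y ⟨hy, hyb⟩
  by_contra hyn
  have h1 : y ∈ frontier Ω := by
    rw [hΩ.frontier_eq]; exact ⟨hy, hyn⟩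
  have := dB_le_dist h1 x
  rw [mem_ball, dist_comm] at hyb
  linarith

lemma chain_aux {E : Type*} [PseudoMetricSpace E] (γ : ℝ → E) (g d : E → ℝ) (A m D : ℝ)
    (hγ : ContinuousOn γ (Icc 0 1)) (hm : 0 < m) (hA : 0 ≤ A)
    (hmd : ∀ τ ∈ Icc (0:ℝ) 1, m ≤ d (γ τ)) (hdD : ∀ τ ∈ Icc (0:ℝ) 1, d (γ τ) ≤ D)
    (hloc : ∀ τ ∈ Icc (0:ℝ) 1, ∀ τ' ∈ Icc (0:ℝ) 1, dist (γ τ) (γ τ') ≤ d (γ τ) / 14 →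
      |g (γ τ) - g (γ τ')| ≤ A * d (γ τ)) :
    ∀ N : ℕ, ∀ a ∈ Icc (0:ℝ) 1, ∀ v : ℝ, 0 ≤ v →
      eVariationOn γ (Icc a 1) ≤ ENNReal.ofReal v → v < N * (m / 14) →
      |g (γ a) - g (γ 1)| ≤ A * (14 * v + D) := by
  intro N
  induction N with
  | zero => intro a _ v hv _ h; simp at h; linarith
  | succ N ih =>
    intro a ha v hv hV hvN
    have h1 : (1:ℝ) ∈ Icc (0:ℝ) 1 := by simp
    by_cases hc : dist (γ a) (γ 1) ≤ d (γ a) / 14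
    · refine (hloc a ha 1 h1 hc).trans ?_
      have := hdD a ha
      gcongr
      linarith
    · push Not at hc
      have hd := hmd a ha
      have hcont : ContinuousOn (fun τ => dist (γ a) (γ τ)) (Icc a 1) := by
        have := hγ.mono (Icc_subset_Icc ha.1 (le_refl (1:ℝ)))
        fun_prop
      obtain ⟨t, ht, hte⟩ := intermediate_value_Icc ha.2 hcont
        (show d (γ a) / 14 ∈ Icc (dist (γ a) (γ a)) (dist (γ a) (γ 1)) from
          ⟨by rw [dist_self]; linarith, hc.le⟩)
      have ht01 : t ∈ Icc (0:ℝ) 1 := ⟨ha.1.trans ht.1, ht.2⟩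
      simp only at hte
      have hadd : eVariationOn γ (Icc a t) + eVariationOn γ (Icc t 1) = eVariationOn γ (Icc a 1) := by
        have := eVariationOn.Icc_add_Icc γ (s := univ) ht.1 ht.2 (mem_univ t)
        simpa using this
      have hle : ENNReal.ofReal (d (γ a) / 14) ≤ eVariationOn γ (Icc a t) := by
        rw [← hte, ← edist_dist]
        exact eVariationOn.edist_le γ ⟨le_rfl, ht.1⟩ ⟨ht.1, le_rfl⟩
      have hsum : ENNReal.ofReal (d (γ a) / 14) + eVariationOn γ (Icc t 1) ≤ ENNReal.ofReal v := by
        calc _ ≤ eVariationOn γ (Icc a t) + eVariationOn γ (Icc t 1) := by gcongr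
          _ ≤ _ := by rw [hadd]; exact hV
      have hv1 : d (γ a) / 14 ≤ v := by
        have : ENNReal.ofReal (d (γ a) / 14) ≤ ENNReal.ofReal v := le_trans le_self_add hsum
        exact (ENNReal.ofReal_le_ofReal_iff hv).1 this
      have hV2 : eVariationOn γ (Icc t 1) ≤ ENNReal.ofReal (v - d (γ a) / 14) := by
        rw [ENNReal.ofReal_sub _ (by linarith)]
        exact ENNReal.le_sub_of_add_le_left ENNReal.ofReal_ne_top hsum
      have h2 := ih t ht01 (v - d (γ a) / 14) (by linarith) hV2
        (by push_cast at hvN; linarith)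
      have h3 := hloc a ha t ht01 hte.le
      calc |g (γ a) - g (γ 1)| ≤ |g (γ a) - g (γ t)| + |g (γ t) - g (γ 1)| := abs_sub_le _ _ _
        _ ≤ A * d (γ a) + A * (14 * (v - d (γ a) / 14) + D) := add_le_add h3 h2
        _ = _ := by ring

lemma chain_bound {E : Type*} [PseudoMetricSpace E] (γ : ℝ → E) (g d : E → ℝ) (A m D v : ℝ)
    (hγ : ContinuousOn γ (Icc 0 1)) (hm : 0 < m) (hA : 0 ≤ A) (hv : 0 ≤ v)
    (hmd : ∀ τ ∈ Icc (0:ℝ) 1, m ≤ d (γ τ)) (hdD : ∀ τ ∈ Icc (0:ℝ) 1, d (γ τ) ≤ D)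
    (hloc : ∀ τ ∈ Icc (0:ℝ) 1, ∀ τ' ∈ Icc (0:ℝ) 1, dist (γ τ) (γ τ') ≤ d (γ τ) / 14 →
      |g (γ τ) - g (γ τ')| ≤ A * d (γ τ))
    (hV : eVariationOn γ (Icc 0 1) ≤ ENNReal.ofReal v) :
    |g (γ 0) - g (γ 1)| ≤ A * (14 * v + D) := by
  obtain ⟨N, hN⟩ := exists_nat_gt (v / (m / 14))
  exact chain_aux γ g d A m D hγ hm hA hmd hdD hloc N 0 (by simp) v hv hV
    ((div_lt_iff₀ (by positivity)).1 hN)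

lemma alphaFun_le (p sv θ : ℝ) (hθ : 1 ≤ θ) :
    (p * sv - n ≤ p ∧ alphaFun n p sv θ ≤ p + θ * (p * sv - n - p)) ∨
    (p < p * sv - n ∧ alphaFun n p sv θ ≤ p * sv - n) := by
  unfold alphaFun
  by_cases h : p * sv - n ≤ p
  · left
    refine ⟨h, ?_⟩
    split_ifs with h1
    · nlinarith
    · push Not at h1
      nlinarith [mul_nonneg (sub_nonneg.2 hθ) (sub_nonneg.2 h1.le)]
  · right
    refine ⟨not_le.1 h, ?_⟩
    rw [if_neg (by linarith)]
    linarith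

lemma alphaFun_continuous (p θ : ℝ) : Continuous (fun sv => alphaFun n p sv θ) := by
  unfold alphaFun
  refine Continuous.if_le (by fun_prop) (by fun_prop) (by fun_prop) (by fun_prop) ?_
  intro x hx
  rw [hx]; ring

lemma alphaLow_eventually (Ω : Set (Euc n)) (s : Euc n → ℝ) (p : ℝ) (θΓ : Euc n → ℝ) (xb : Euc n)
    (hs0 : ∀ x, 0 ≤ s x) (hsb : ∃ b : ℝ, ∀ x, s x ≤ b) (hxb : xb ∈ frontier Ω)
    (a : ℝ) (ha : a < alphaLow0 Ω s p θΓ xb) :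
    ∀ᶠ δ in 𝓝[>] (0:ℝ), a < alphaLow Ω s p θΓ xb δ := by
  obtain ⟨b, hb⟩ := hsb
  have hne : ∀ δ > 0, (Ω ∩ ball xb δ).Nonempty := by
    intro δ hδ
    obtain ⟨y, hy, hd⟩ := Metric.mem_closure_iff.1 (frontier_subset_closure hxb) δ hδ
    exact ⟨y, hy, by rwa [mem_ball, dist_comm]⟩
  have hbb : ∀ δ, BddBelow (s '' (Ω ∩ ball xb δ)) := by
    intro δ
    refine ⟨0, ?_⟩
    rintro _ ⟨y, _, rfl⟩
    exact hs0 y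
  have hanti : AntitoneOn (fun δ => sLow Ω s xb δ) (Ioi 0) := by
    intro δ hδ δ' hδ' hle
    exact csInf_le_csInf (hbb _) ((hne δ hδ).image s)
      (image_mono (inter_subset_inter_right _ (ball_subset_ball hle)))
  have hbdd : BddAbove ((fun δ => sLow Ω s xb δ) '' Ioi 0) := by
    refine ⟨b, ?_⟩
    rintro _ ⟨δ, hδ, rfl⟩
    obtain ⟨y, hy⟩ := hne δ hδ
    exact (csInf_le (hbb δ) ⟨y, hy, rfl⟩).trans (hb y)
  have ht := hanti.tendsto_nhdsGT hbdd
  have ht2 : Tendsto (fun δ => alphaLow Ω s p θΓ xb δ) (𝓝[>] 0)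
      (𝓝 (alphaFun n p (sSup ((fun δ => sLow Ω s xb δ) '' Ioi 0)) (θΓ xb))) :=
    ((alphaFun_continuous (n := n) p (θΓ xb)).tendsto _).comp ht
  have heq : alphaLow0 Ω s p θΓ xb = _ := ht2.limUnder_eq
  rw [heq] at ha
  exact ht2.eventually (lt_mem_nhds ha)

lemma sLow_le {Ω : Set (Euc n)} {s : Euc n → ℝ} {xb : Euc n} (hs0 : ∀ x, 0 ≤ s x) {δ : ℝ}
    {y : Euc n} (hy : y ∈ Ω) (hyb : y ∈ ball xb δ) : sLow Ω s xb δ ≤ s y := by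
  refine csInf_le ⟨0, ?_⟩ ⟨y, ⟨hy, hyb⟩, rfl⟩
  rintro _ ⟨y, _, rfl⟩
  exact hs0 y

lemma sLow_nonneg {Ω : Set (Euc n)} {s : Euc n → ℝ} {xb : Euc n} (hs0 : ∀ x, 0 ≤ s x) {δ : ℝ} :
    0 ≤ sLow Ω s xb δ := by
  refine Real.sInf_nonneg ?_
  rintro _ ⟨y, _, rfl⟩
  exact hs0 y

lemma nuInt_nonneg (Ω : Set (Euc n)) (s : Euc n → ℝ) (p : ℝ) (u : Euc n → ℝ) (x : Euc n) :
    0 ≤ nuInt Ω s p u x := by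
  unfold nuInt
  refine mul_nonneg (Real.rpow_nonneg ?_ _) (Real.rpow_nonneg (dB_nonneg Ω x) _)
  rw [setAverage_eq]
  exact smul_nonneg (by positivity) (integral_nonneg fun y => abs_nonneg _)

lemma nuM_nonneg (Ω : Set (Euc n)) (s : Euc n → ℝ) (p : ℝ) (u : Euc n → ℝ) (E : Set (Euc n)) :
    0 ≤ nuM Ω s p u E := integral_nonneg fun x => nuInt_nonneg Ω s p u x

lemma nuM_mono {Ω : Set (Euc n)} {s : Euc n → ℝ} {p : ℝ} {u : Euc n → ℝ} 
    (hu : MemN Ω s p u) {E F : Set (Euc n)} (h : Ω ∩ E ⊆ Ω ∩ F) :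
    nuM Ω s p u E ≤ nuM Ω s p u F := by
  unfold nuM
  refine setIntegral_mono_set (hu.2.mono_set inter_subset_left) ?_ ?_
  · exact Eventually.of_forall fun x => nuInt_nonneg Ω s p u x
  · exact h.eventuallyLE

lemma Mtau_bound {Ω : Set (Euc n)} {s : Euc n → ℝ} {p : ℝ} {u : Euc n → ℝ} {Γ : Set (Euc n)}
    {τ δΓ : ℝ} (hτ : 0 ≤ τ) (hu : MemN Ω s p u) {xb : Euc n}
    (h : xb ∈ GammaTau Ω s p u Γ τ) {ρ : ℝ} (hρ : 0 < ρ) (hρ1 : ρ ≤ δΓ) :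
    nuM Ω s p u (ball xb ρ) ≤ Mtau Ω s p u δΓ τ xb * ρ ^ τ := by
  obtain ⟨-, M, hM⟩ := h
  have hbdd : BddAbove ((fun ρ => ρ ^ (-τ) * nuM Ω s p u (ball xb ρ)) '' Ioc 0 δΓ) := by
    obtain ⟨r, hr, hrM⟩ := mem_nhdsGT_iff_exists_Ioo_subset.1 hM
    simp only [mem_Ioi] at hr
    refine ⟨max M (r ^ (-τ) * nuM Ω s p u univ), ?_⟩
    rintro _ ⟨a, ha, rfl⟩
    by_cases har : a < r
    · exact le_max_of_le_left (hrM ⟨ha.1, har⟩)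
    · push Not at har
      refine le_max_of_le_right ?_
      refine mul_le_mul ?_ (nuM_mono hu (by gcongr; simp)) (nuM_nonneg ..) (by positivity)
      exact Real.rpow_le_rpow_of_nonpos hr har (by linarith)
  have h1 : ρ ^ (-τ) * nuM Ω s p u (ball xb ρ) ≤ Mtau Ω s p u δΓ τ xb :=
    le_csSup hbdd ⟨ρ, ⟨hρ, hρ1⟩, rfl⟩
  rw [Real.rpow_neg hρ.le, inv_mul_le_iff₀ (by positivity)] at h1
  linarith

lemma Mtau_nonneg (Ω : Set (Euc n)) (s : Euc n → ℝ) (p : ℝ) (u : Euc n → ℝ)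
    (τ δΓ : ℝ) (xb : Euc n) : 0 ≤ Mtau Ω s p u δΓ τ xb := by
  refine Real.sSup_nonneg ?_
  rintro _ ⟨a, ha, rfl⟩
  exact mul_nonneg (Real.rpow_nonneg ha.1.le _) (nuM_nonneg ..)

lemma abs_avg_sub_le {S : Set (Euc n)} {u : Euc n → ℝ} (hu : IntegrableOn u S)
    (h0 : volume S ≠ 0) (ht : volume S ≠ ⊤) (c : ℝ) :
    |(⨍ y in S, u y) - c| ≤ ⨍ y in S, |u y - c| := by
  have hpos : 0 < volume.real S := ENNReal.toReal_pos h0 ht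
  have hc : IntegrableOn (fun _ : Euc n => c) S := integrableOn_const ht
  have h1 : (⨍ y in S, u y) - c = (volume.real S)⁻¹ * ∫ y in S, (u y - c) := by
    rw [setAverage_eq, integral_sub hu hc, setIntegral_const]
    simp only [smul_eq_mul]
    field_simp
  rw [h1, abs_mul, abs_of_pos (inv_pos.2 hpos), setAverage_eq, smul_eq_mul]
  gcongr
  exact abs_integral_le_integral_abs

lemma vol_ball (x : Euc n) {r : ℝ} (hr : 0 < r) :
    volume.real (ball x r) = r ^ n * volume.real (ball (0 : Euc n) 1) := by
  rw [measureReal_def, Measure.addHaar_ball_of_pos _ _ hr, ENNReal.toReal_mul,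
    ENNReal.toReal_ofReal (by positivity), measureReal_def]
  simp

lemma vol_unit_pos : 0 < volume.real (ball (0 : Euc n) 1) :=
  ENNReal.toReal_pos (measure_ball_pos volume _ one_pos).ne' measure_ball_lt_top.ne

lemma ptwise_est {Ω : Set (Euc n)} (hΩ : IsOpen Ω) (hf : (frontier Ω).Nonempty)
    {u : Euc n → ℝ} (hu : IntegrableOn u Ω) {x x' y : Euc n} (hx : x ∈ Ω)
    (hxx : dist x x' ≤ dB Ω x / 14) (hy : y ∈ PhiB Ω x) :
    |u y - gFun Ω u x'| ≤ 4 ^ n * ⨍ z in PsiB Ω y, |u z - u y| := by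
  have hd := dB_pos hΩ hf hx
  set d := dB Ω x with hd_def
  have hy' : dist y x < d / 6 := hy
  have h1 := dB_le_add Ω x x'
  have h2 := dB_le_add Ω x' x
  have h3 := dB_le_add Ω x y
  have h4 := dB_le_add Ω y x
  rw [dist_comm x' x] at h2
  rw [dist_comm x y] at h3
  have hyΩ : y ∈ Ω := ball_dB_subset hΩ hf hx (by rw [mem_ball]; linarith)
  have hsub : PhiB Ω x' ⊆ PsiB Ω y := by
    intro z hz
    have hz' : dist z x' < dB Ω x' / 6 := hz
    show dist z y < dB Ω y / 2
    have t1 := dist_triangle z x' y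
    have t2 := dist_triangle x' x y
    rw [dist_comm x' x, dist_comm x y] at t2
    linarith
  have hPsi : PsiB Ω y ⊆ Ω :=
    (ball_subset_ball (by linarith [dB_nonneg Ω y])).trans (ball_dB_subset hΩ hf hyΩ)
  have hr' : 0 < dB Ω x' / 6 := by linarith
  have hry : 0 < dB Ω y / 2 := by linarith
  have hiPsi : IntegrableOn (fun z => |u z - u y|) (PsiB Ω y) := by
    refine Integrable.abs ?_
    exact (hu.mono_set hPsi).sub (integrableOn_const measure_ball_lt_top.ne)
  have hv := vol_unit_pos (n := n)
  rw [abs_sub_comm]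
  have hpos' : 0 < volume.real (PhiB Ω x') := by
    unfold PhiB; rw [vol_ball _ hr']; positivity
  have hposy : 0 < volume.real (PsiB Ω y) := by
    unfold PsiB; rw [vol_ball _ hry]; positivity
  have hratio : (volume.real (PhiB Ω x'))⁻¹ ≤ 4 ^ n * (volume.real (PsiB Ω y))⁻¹ := by
    rw [← div_eq_mul_inv, le_div_iff₀ hposy, inv_mul_le_iff₀ hpos']
    unfold PsiB PhiB
    rw [vol_ball _ hr', vol_ball _ hry, mul_right_comm, ← mul_pow]
    gcongr
    linarith
  calc _ ≤ ⨍ z in PhiB Ω x', |u z - u y| :=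
        abs_avg_sub_le (hu.mono_set (hsub.trans hPsi)) (measure_ball_pos volume _ hr').ne'
          measure_ball_lt_top.ne _
    _ = (volume.real (PhiB Ω x'))⁻¹ * ∫ z in PhiB Ω x', |u z - u y| := by
        rw [setAverage_eq, smul_eq_mul]
    _ ≤ (4 ^ n * (volume.real (PsiB Ω y))⁻¹) * ∫ z in PsiB Ω y, |u z - u y| := by
        refine mul_le_mul hratio ?_ (integral_nonneg fun _ => abs_nonneg _) (by positivity)
        exact setIntegral_mono_set hiPsi (Eventually.of_forall fun _ => abs_nonneg _)
          hsub.eventuallyLE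
    _ = _ := by rw [setAverage_eq, smul_eq_mul]; ring

lemma local_est (n : ℕ) (p σ : ℝ) (hp : 1 ≤ p) (hσ : 0 ≤ σ) : ∃ K : ℝ, 0 < K ∧
    ∀ (Ω : Set (Euc n)), IsOpen Ω → (frontier Ω).Nonempty → ∀ (s u : Euc n → ℝ), MemN Ω s p u →
    ∀ (F : Set (Euc n)), ∀ x ∈ Ω, ∀ x', dist x x' ≤ dB Ω x / 14 →
    (∀ y ∈ PhiB Ω x, σ ≤ s y) → (∀ y ∈ PhiB Ω x, dB Ω y ≤ 1) → PhiB Ω x ⊆ F →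
    |gFun Ω u x - gFun Ω u x'| ≤ K * dB Ω x ^ (σ - n / p) * nuM Ω s p u F ^ (1 / p) := by
  have hv := vol_unit_pos (n := n)
  set v := volume.real (ball (0 : Euc n) 1)
  have hp0 : 0 < p := by linarith
  set K0 : ℝ := (6 ^ n / v) * (4 ^ n) ^ p * (7 / 6) ^ (p * σ) with hK0
  have hK0pos : 0 < K0 := by positivity
  refine ⟨K0 ^ (1 / p), by positivity, ?_⟩
  intro Ω hΩ hf s u hu F x hx x' hxx hs hd1 hF
  have hd := dB_pos hΩ hf hx
  set d := dB Ω x with hd_def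
  set c := gFun Ω u x' with hc
  have hr : 0 < d / 6 := by linarith
  have hPΩ : PhiB Ω x ⊆ Ω := (ball_subset_ball (by linarith)).trans (ball_dB_subset hΩ hf hx)
  have hvol : volume.real (PhiB Ω x) = (d / 6) ^ n * v := vol_ball x hr
  have hvpos : 0 < volume.real (PhiB Ω x) := by rw [hvol]; positivity
  have h0 : volume (PhiB Ω x) ≠ 0 := (measure_ball_pos volume _ hr).ne'
  have ht : volume (PhiB Ω x) ≠ ⊤ := measure_ball_lt_top.ne
  have hui : IntegrableOn u (PhiB Ω x) := hu.1.mono_set hPΩ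
  have hni : IntegrableOn (nuInt Ω s p u) (PhiB Ω x) := hu.2.mono_set hPΩ
  set B : ℝ := (4 ^ n) ^ p * (7 / 6 * d) ^ (p * σ) with hB
  have hpt : ∀ y ∈ PhiB Ω x, |u y - c| ^ p ≤ B * nuInt Ω s p u y := by
    intro y hy
    have hyΩ := hPΩ hy
    have hdy := dB_pos hΩ hf hyΩ
    have hyd : dist y x < d / 6 := hy
    have h4 := dB_le_add Ω y x
    have h5 := ptwise_est hΩ hf hu.1 hx hxx hy
    set h := ⨍ z in PsiB Ω y, |u z - u y| with hh
    have hh0 : 0 ≤ h := by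
      rw [hh, setAverage_eq]
      exact smul_nonneg (by positivity) (integral_nonneg fun y => abs_nonneg _)
    have h6 : h ^ p = nuInt Ω s p u y * dB Ω y ^ (p * s y) := by
      unfold nuInt
      rw [mul_assoc, ← Real.rpow_add hdy]; simp [hh]
    have h7 : dB Ω y ^ (p * s y) ≤ (7 / 6 * d) ^ (p * σ) := by
      calc _ ≤ dB Ω y ^ (p * σ) := by
            apply Real.rpow_le_rpow_of_exponent_ge hdy (hd1 y hy)
            have := hs y hy
            gcongr
        _ ≤ _ := by
            apply Real.rpow_le_rpow hdy.le (by linarith) (by positivity)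
    calc |u y - c| ^ p ≤ (4 ^ n * h) ^ p := by gcongr
      _ = (4 ^ n) ^ p * h ^ p := Real.mul_rpow (by positivity) hh0
      _ ≤ (4 ^ n) ^ p * (nuInt Ω s p u y * (7 / 6 * d) ^ (p * σ)) := by
          rw [h6]
          have := nuInt_nonneg Ω s p u y
          gcongr
      _ = _ := by rw [hB]; ring
  have huc : IntegrableOn (fun y => |u y - c|) (PhiB Ω x) :=
    Integrable.abs (hui.sub (integrableOn_const ht))
  have hucp : IntegrableOn (fun y => |u y - c| ^ p) (PhiB Ω x) := by
    refine Integrable.mono' (hni.const_mul B) ?_ ?_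
    · exact (huc.aestronglyMeasurable.aemeasurable.pow_const p).aestronglyMeasurable
    · rw [ae_restrict_iff' (show MeasurableSet (PhiB Ω x) from measurableSet_ball)]
      refine Eventually.of_forall fun y hy => ?_
      rw [Real.norm_of_nonneg (by positivity)]
      exact hpt y hy
  have hJ : (⨍ y in PhiB Ω x, |u y - c|) ^ p ≤ ⨍ y in PhiB Ω x, |u y - c| ^ p := by
    refine (convexOn_rpow hp).map_set_average_le ?_ isClosed_Ici h0 ht ?_ huc hucp
    · exact (Real.continuous_rpow_const hp0.le).continuousOn
    · exact Eventually.of_forall fun y => abs_nonneg (u y - c)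
  have hN := nuM_nonneg Ω s p u F
  have hmain : |gFun Ω u x - c| ^ p ≤ K0 * d ^ (p * σ - n) * nuM Ω s p u F := by
    calc |gFun Ω u x - c| ^ p ≤ (⨍ y in PhiB Ω x, |u y - c|) ^ p := by
          have := abs_avg_sub_le hui h0 ht c
          unfold gFun
          gcongr
      _ ≤ ⨍ y in PhiB Ω x, |u y - c| ^ p := hJ
      _ = (volume.real (PhiB Ω x))⁻¹ * ∫ y in PhiB Ω x, |u y - c| ^ p := by
          rw [setAverage_eq, smul_eq_mul]
      _ ≤ (volume.real (PhiB Ω x))⁻¹ * ∫ y in PhiB Ω x, B * nuInt Ω s p u y := by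
          gcongr ?_ * ?_
          exact setIntegral_mono_on hucp (hni.const_mul B) measurableSet_ball hpt
      _ ≤ (volume.real (PhiB Ω x))⁻¹ * (B * nuM Ω s p u F) := by
          rw [integral_const_mul]
          gcongr
          exact setIntegral_mono_set (hu.2.mono_set inter_subset_left)
            (Eventually.of_forall fun x => nuInt_nonneg Ω s p u x)
            (subset_inter hPΩ hF).eventuallyLE
      _ = _ := by
          rw [hvol, hB, hK0, Real.mul_rpow (by norm_num) hd.le, Real.rpow_sub hd,
            Real.rpow_natCast, div_pow]
          field_simp
  have h8 : (|gFun Ω u x - c| ^ p) ^ (1 / p) ≤ (K0 * d ^ (p * σ - n) * nuM Ω s p u F) ^ (1 / p) := by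
    gcongr
  rw [← Real.rpow_mul (abs_nonneg _), mul_one_div_cancel hp0.ne', Real.rpow_one,
    Real.mul_rpow (by positivity) hN, Real.mul_rpow hK0pos.le (by positivity),
    ← Real.rpow_mul hd.le] at h8
  convert h8 using 4
  field_simp

/-- The weight along a path. -/
lemma weight_est (p σ θ C e ρ : ℝ) (hp : 1 ≤ p) (hσ : 0 ≤ σ) (hθ : 1 ≤ θ) (hC : 1 ≤ C)
    (he : 0 < e) (he1 : e ≤ 1) (hρ : 0 < ρ) (hρ1 : ρ ≤ 1) :
    ∃ W : ℝ, 0 ≤ W ∧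
      W * ρ ≤ (2 * C) ^ |σ - n / p - 1| * e ^ (-((n : ℝ) + p) / p) * ρ ^ (alphaFun n p σ θ / p) ∧
      ∀ d : ℝ, e * ρ ^ θ ≤ d → d ≤ 2 * C * ρ → d ^ (σ - n / p) ≤ W * d := by
  have hp0 : 0 < p := by linarith
  set q := σ - n / p with hq
  have hpq : p * σ - n = p * q := by rw [hq]; field_simp
  have hC2 : 1 ≤ (2 * C) ^ |q - 1| := Real.one_le_rpow (by linarith) (abs_nonneg _)
  have hm : 0 < e * ρ ^ θ := by positivity
  have hexp : -((n : ℝ) + p) / p ≤ 0 := by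
    rw [div_le_iff₀ hp0]
    have : (0:ℝ) ≤ n := Nat.cast_nonneg n
    linarith
  have hdq : ∀ d : ℝ, 0 < d → d ^ q = d ^ (q - 1) * d := by
    intro d hd
    rw [Real.rpow_sub_one hd.ne']; field_simp
  rcases alphaFun_le (n := n) p σ θ hθ with ⟨h1, h2⟩ | ⟨h1, h2⟩
  · rw [hpq] at h1 h2
    have hq1 : q ≤ 1 := by nlinarith
    refine ⟨(e * ρ ^ θ) ^ (q - 1), by positivity, ?_, ?_⟩
    · have e1 : (e * ρ ^ θ) ^ (q - 1) * ρ = e ^ (q - 1) * ρ ^ (1 + θ * (q - 1)) := by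
        rw [Real.mul_rpow he.le (by positivity), ← Real.rpow_mul hρ.le, Real.rpow_add hρ,
          Real.rpow_one]; ring
      rw [e1]
      have e2 : e ^ (q - 1) ≤ e ^ (-((n : ℝ) + p) / p) := by
        apply Real.rpow_le_rpow_of_exponent_ge he he1
        rw [div_le_iff₀ hp0]
        nlinarith
      have e3 : ρ ^ (1 + θ * (q - 1)) ≤ ρ ^ (alphaFun n p σ θ / p) := by
        apply Real.rpow_le_rpow_of_exponent_ge hρ hρ1
        rw [div_le_iff₀ hp0]
        nlinarith
      calc _ ≤ e ^ (-((n : ℝ) + p) / p) * ρ ^ (alphaFun n p σ θ / p) := by gcongr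
        _ ≤ (2 * C) ^ |q - 1| * (e ^ (-((n : ℝ) + p) / p) * ρ ^ (alphaFun n p σ θ / p)) :=
            le_mul_of_one_le_left (by positivity) hC2
        _ = _ := by ring
    · intro d hd _
      rw [hdq d (hm.trans_le hd)]
      have hd0 := hm.trans_le hd
      gcongr ?_ * _
      exact Real.rpow_le_rpow_of_nonpos hm hd (by linarith)
  · rw [hpq] at h1 h2
    have hq1 : 1 < q := by nlinarith
    refine ⟨(2 * C * ρ) ^ (q - 1), by positivity, ?_, ?_⟩
    · have e1 : (2 * C * ρ) ^ (q - 1) * ρ = (2 * C) ^ (q - 1) * ρ ^ q := by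
        rw [Real.mul_rpow (by positivity) hρ.le, hdq ρ hρ]; ring
      rw [e1, abs_of_pos (by linarith)]
      have e2 : 1 ≤ e ^ (-((n : ℝ) + p) / p) :=
        Real.one_le_rpow_of_pos_of_le_one_of_nonpos he he1 hexp
      have e3 : ρ ^ q ≤ ρ ^ (alphaFun n p σ θ / p) := by
        apply Real.rpow_le_rpow_of_exponent_ge hρ hρ1
        rw [div_le_iff₀ hp0]
        linarith
      have hC0 : 0 ≤ (2 * C) ^ (q - 1) := by positivity
      calc _ ≤ (2 * C) ^ (q - 1) * ρ ^ (alphaFun n p σ θ / p) := by gcongr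
        _ ≤ e ^ (-((n : ℝ) + p) / p) * ((2 * C) ^ (q - 1) * ρ ^ (alphaFun n p σ θ / p)) :=
            le_mul_of_one_le_left (by positivity) e2
        _ = _ := by ring
    · intro d hd hd2
      have hd0 := hm.trans_le hd
      rw [hdq d hd0]
      gcongr

lemma two_point (p CΓ δΓ : ℝ) (hp : 1 ≤ p) (hCΓ : 1 ≤ CΓ) (hδΓ0 : 0 < δΓ) (hδΓ1 : δΓ < 1)
    (Ω : Set (Euc n)) (hΩ : IsOpen Ω) (Γ : Set (Euc n)) (hΓ : Γ ⊆ frontier Ω)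
    (θΓ : Euc n → ℝ) (hθ : ∀ xb, 1 ≤ θΓ xb)
    (s : Euc n → ℝ) (hs0 : ∀ x, 0 ≤ s x) (hsb : ∃ b : ℝ, ∀ x, s x ≤ b)
    (ε : ℝ → ℝ)
    (hconn : ∀ xb ∈ Γ, ConnectedTo Ω (Ω ∩ ball xb δΓ) xb CΓ (θΓ xb) (δΓ / (3 * CΓ)) ε)
    (u : Euc n → ℝ) (hu : MemN Ω s p u) (τ₀ ω₀ : ℝ) (hτ : 0 ≤ τ₀)
    (xb : Euc n) (hxb : xb ∈ Γ) (hα : 0 ≤ alphaLow0 Ω s p θΓ xb + ω₀)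
    (hG : xb ∈ GammaTau Ω s p u Γ τ₀) (β : ℝ) (hβ : β < (τ₀ - ω₀) / p) :
    ∃ K ρ₂ : ℝ, 0 < K ∧ 0 < ρ₂ ∧ ∀ lam : ℝ, 0 < lam → lam < 1 →
      ∀ ρ : ℝ, 0 < ρ → ρ ≤ ρ₂ → ∀ x ∈ Ω ∩ ball xb ρ, ∀ x' ∈ Ω ∩ ball xb ρ,
        (lam * ρ) ^ (θΓ xb) ≤ dB Ω x → (lam * ρ) ^ (θΓ xb) ≤ dB Ω x' →
        |gFun Ω u x - gFun Ω u x'| ≤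
          K * (ε lam ^ (-((n : ℝ) + p) / p) * Mtau Ω s p u δΓ τ₀ xb ^ (1 / p)) * ρ ^ β := by
  have hp0 : 0 < p := by linarith
  have hxf := hΓ hxb
  have hf : (frontier Ω).Nonempty := ⟨xb, hxf⟩
  have hβ2 : p * β - τ₀ < alphaLow0 Ω s p θΓ xb := by
    rw [lt_div_iff₀ hp0] at hβ
    linarith
  obtain ⟨δ, hαδ, hδ0, hδΓ⟩ := ((alphaLow_eventually Ω s p θΓ xb hs0 hsb hxf _ hβ2).and
    (Ioc_mem_nhdsGT hδΓ0)).exists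
  set σ := sLow Ω s xb δ with hσ
  have hσ0 : 0 ≤ σ := sLow_nonneg hs0
  obtain ⟨K1, hK1, hloc⟩ := local_est n p σ hp hσ0
  set M := Mtau Ω s p u δΓ τ₀ xb with hM
  have hM0 : 0 ≤ M := Mtau_nonneg ..
  refine ⟨K1 * (2 * CΓ) ^ |σ - n / p - 1| * (3 * CΓ) ^ (τ₀ / p) * (16 * CΓ), δ / (3 * CΓ),
    by positivity, by positivity, ?_⟩
  intro lam hl0 hl1 ρ hρ hρ2 x hx x' hx' hdx hdx'
  have hρδ : 3 * CΓ * ρ ≤ δ := by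
    rw [le_div_iff₀ (by positivity)] at hρ2; linarith
  have hρ1 : ρ ≤ 1 := by nlinarith
  have hρb : ρ < δΓ := by nlinarith
  obtain ⟨he0, he1, hpath⟩ := hconn xb hxb lam hl0 hl1
  obtain ⟨γ, hγc, hγ0, hγ1, hγE, hγV⟩ := hpath ρ hρ
    (hρ2.trans (by gcongr)) x ⟨⟨hx.1, ball_subset_ball hρb.le hx.2⟩, hx.2⟩
    x' ⟨⟨hx'.1, ball_subset_ball hρb.le hx'.2⟩, hx'.2⟩ hdx hdx'
  set e := ε lam with he
  obtain ⟨W, hW0, hWρ, hW⟩ := weight_est (n := n) p σ (θΓ xb) CΓ e ρ hp hσ0 (hθ xb) hCΓ he0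
    (he1.trans hl1.le) hρ hρ1
  set N := nuM Ω s p u (ball xb (3 * CΓ * ρ)) with hN
  have hN0 : 0 ≤ N := nuM_nonneg ..
  have hNM : N ^ (1 / p) ≤ M ^ (1 / p) * ((3 * CΓ) ^ (τ₀ / p) * ρ ^ (τ₀ / p)) := by
    have h1 : N ≤ M * (3 * CΓ * ρ) ^ τ₀ :=
      Mtau_bound hτ hu hG (by positivity) (hρδ.trans hδΓ)
    calc N ^ (1 / p) ≤ (M * (3 * CΓ * ρ) ^ τ₀) ^ (1 / p) := by gcongr
      _ = _ := by
        rw [Real.mul_rpow hM0 (by positivity), ← Real.rpow_mul (by positivity),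
          Real.mul_rpow (by positivity) hρ.le]
        simp only [mul_one_div]
  -- points of the path stay close to `xb`
  have hclose : ∀ τ ∈ Icc (0:ℝ) 1, dist (γ τ) xb < 2 * CΓ * ρ := by
    intro τ hτ
    have h1 : edist (γ τ) (γ 0) ≤ ENNReal.ofReal (CΓ * ρ) :=
      (eVariationOn.edist_le γ hτ (by simp)).trans hγV
    rw [edist_dist, ENNReal.ofReal_le_ofReal_iff (by positivity), hγ0] at h1
    have h2 : dist x xb < ρ := hx.2
    have := dist_triangle (γ τ) x xb
    nlinarith
  have hdD : ∀ τ ∈ Icc (0:ℝ) 1, dB Ω (γ τ) ≤ 2 * CΓ * ρ := fun τ hτ =>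
    (dB_le_dist hxf _).trans (hclose τ hτ).le
  have hmain := chain_bound γ (gFun Ω u) (dB Ω) (K1 * W * N ^ (1 / p)) (e * ρ ^ (θΓ xb))
    (2 * CΓ * ρ) (CΓ * ρ) hγc (by positivity) (by positivity) (by positivity)
    (fun τ hτ => (hγE τ hτ).2) hdD ?_ hγV
  · rw [hγ0, hγ1] at hmain
    have hexp : ρ ^ (alphaFun n p σ (θΓ xb) / p) * ρ ^ (τ₀ / p) ≤ ρ ^ β := by
      rw [← Real.rpow_add hρ]
      apply Real.rpow_le_rpow_of_exponent_ge hρ hρ1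
      rw [← add_div, le_div_iff₀ hp0]
      unfold alphaLow at hαδ
      linarith
    calc _ ≤ _ := hmain
      _ = K1 * (W * ρ) * N ^ (1 / p) * (16 * CΓ) := by ring
      _ ≤ K1 * ((2 * CΓ) ^ |σ - n / p - 1| * e ^ (-((n : ℝ) + p) / p)
            * ρ ^ (alphaFun n p σ (θΓ xb) / p)) *
          (M ^ (1 / p) * ((3 * CΓ) ^ (τ₀ / p) * ρ ^ (τ₀ / p))) * (16 * CΓ) := by gcongr
      _ = K1 * (2 * CΓ) ^ |σ - n / p - 1| * (3 * CΓ) ^ (τ₀ / p) * (16 * CΓ) *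
          (e ^ (-((n : ℝ) + p) / p) * M ^ (1 / p)) *
          (ρ ^ (alphaFun n p σ (θΓ xb) / p) * ρ ^ (τ₀ / p)) := by ring
      _ ≤ _ := by gcongr
  · intro τ hτ τ' hτ' hdist
    have hwΩ := (hγE τ hτ).1.1
    have hPhi : PhiB Ω (γ τ) ⊆ ball xb (3 * CΓ * ρ) := by
      intro y hy
      have h1 : dist y (γ τ) < dB Ω (γ τ) / 6 := hy
      have h2 := hclose τ hτ
      have h3 := hdD τ hτ
      have := dist_triangle y (γ τ) xb
      rw [mem_ball]
      nlinarith
    have hPΩ : PhiB Ω (γ τ) ⊆ Ω :=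
      (ball_subset_ball (by linarith [dB_nonneg Ω (γ τ)])).trans (ball_dB_subset hΩ hf hwΩ)
    have h1 := hloc Ω hΩ hf s u hu (ball xb (3 * CΓ * ρ)) (γ τ) hwΩ (γ τ') hdist
      (fun y hy => sLow_le hs0 (hPΩ hy) (ball_subset_ball hρδ (hPhi hy)))
      (fun y hy => by
        have h4 : dist y xb < 3 * CΓ * ρ := hPhi hy
        have := dB_le_dist hxf y
        linarith) hPhi
    have h2 := hW _ (hγE τ hτ).2 (hdD τ hτ)
    calc _ ≤ _ := h1
      _ ≤ K1 * (W * dB Ω (γ τ)) * N ^ (1 / p) := by gcongr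
      _ = _ := by ring

lemma pow_near {η a : ℝ} (hη : 0 < η) (hη1 : η < 1) (ha : 0 < a) (ha1 : a < 1) :
    ∃ j : ℕ, η ^ (j + 1) ≤ a ∧ a < η ^ j := by
  obtain ⟨j, h1, h2⟩ := exists_nat_pow_near_of_lt_one ha ha1.le hη hη1
  rcases h2.lt_or_eq with h | h
  · exact ⟨j, h1.le, h⟩
  · cases j with
    | zero => simp at h; linarith
    | succ j =>
      refine ⟨j, h.ge, ?_⟩
      rw [h, pow_succ]
      exact mul_lt_of_lt_one_right (by positivity) hη1

set_option maxHeartbeats 2000000 in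
/-- existence of the boundary limit of `g`. Under (H1) and (H2), at points
`xb ∈ A_{ω₀,0} ∩ Γ_{τ₀}` (`ω₀ < τ₀`), `g(·;u)` has a limit `L` along every approach region
`Q_λ(xb)`, with the quantitative Hölder-type estimate
`|L − g(x;u)| ≤ C M_{τ₀}(xb)^{1/p} ‖xb − x‖^β` on `Q_{λ,δ_β}(xb)`, where
`C = c ε_{λ′}^{-(n+p)/p} η₀^{−β}(1−η₀^β)^{−1}`, `λ′ = η₀² min{λ₀, λ}`. -/
theorem statement8 (n : ℕ) (hn : 1 ≤ n) (p t CΓ δΓ : ℝ)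
    (hp : 1 ≤ p) (ht : 0 ≤ t) (htn : t < n) (hCΓ : 1 ≤ CΓ) (hδΓ0 : 0 < δΓ) (hδΓ1 : δΓ < 1) :
    ∃ c : ℝ, 0 < c ∧
      ∀ (Ω : Set (Euc n)), IsOpen Ω → Ω.Nonempty → (frontier Ω).Nonempty →
      ∀ (Γ : Set (Euc n)), Γ ⊆ frontier Ω →
      ∀ (θΓ : Euc n → ℝ), (∀ xb, 1 ≤ θΓ xb) → (∃ b : ℝ, ∀ xb, θΓ xb ≤ b) →
      ∀ (s : Euc n → ℝ), Measurable s → (∀ x, 0 ≤ s x) → (∃ b : ℝ, ∀ x, s x ≤ b) →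
      ∀ (lam₀ η₀ : ℝ), 0 < lam₀ → lam₀ < 1 → 0 < η₀ → η₀ < 1 →
      (∀ xb ∈ Γ, IsCorkscrew Ω (Qreg Ω lam₀ (θΓ xb) xb) xb η₀ (θΓ xb) δΓ) →
      ∀ (ε : ℝ → ℝ), (∀ a b : ℝ, 0 < a → a ≤ b → b < 1 → ε a ≤ ε b) →
      (∀ xb ∈ Γ, ConnectedTo Ω (Ω ∩ ball xb δΓ) xb CΓ (θΓ xb) (δΓ / (3 * CΓ)) ε) →
      ∀ (u : Euc n → ℝ), MemN Ω s p u →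
      ∀ (τ₀ ω₀ : ℝ), 0 ≤ τ₀ → ω₀ < τ₀ →
      ∀ xb ∈ Γ, 0 ≤ alphaLow0 Ω s p θΓ xb + ω₀ → xb ∈ GammaTau Ω s p u Γ τ₀ →
        ∃ L : ℝ,
          (∀ lam : ℝ, 0 < lam → lam < 1 →
            Tendsto (gFun Ω u) (𝓝[Qreg Ω lam (θΓ xb) xb] xb) (𝓝 L)) ∧
          ∀ β : ℝ, 0 < β → β < (τ₀ - ω₀) / p →
            ∃ δβ : ℝ, 0 < δβ ∧
              ∀ lam : ℝ, 0 < lam → lam < 1 →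
                ∀ x ∈ Qreg Ω lam (θΓ xb) xb ∩ ball xb δβ,
                  |L - gFun Ω u x| ≤
                    (c * ε (η₀ ^ 2 * min lam₀ lam) ^ (-((n : ℝ) + p) / p) *
                        η₀ ^ (-β) * (1 - η₀ ^ β)⁻¹) *
                      Mtau Ω s p u δΓ τ₀ xb ^ (1 / p) * dist xb x ^ β := by
  refine ⟨1, one_pos, ?_⟩
  intro Ω hΩ _ hf Γ hΓ θΓ hθ _ s _ hs0 hsb lam₀ η₀ hl0 hl1 hη0 hη1 hcork ε _ hconn u hu τ₀ ω₀ hτ hω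
    xb hxb hα hG
  have hp0 : 0 < p := by linarith
  have hTP := two_point p CΓ δΓ hp hCΓ hδΓ0 hδΓ1 Ω hΩ Γ hΓ θΓ hθ s hs0 hsb ε hconn u hu τ₀ ω₀ hτ
    xb hxb hα hG
  set θ := θΓ xb with hθdef
  have hθ0 : 0 ≤ θ := by linarith [hθ xb]
  set M := Mtau Ω s p u δΓ τ₀ xb with hM
  have hM0 : 0 ≤ M := Mtau_nonneg ..
  set r : ℕ → ℝ := fun k => η₀ ^ k * δΓ with hr
  have hrpos : ∀ k, 0 < r k := fun k => by simp only [hr]; positivity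
  have hrle : ∀ k, r k ≤ δΓ := fun k =>
    mul_le_of_le_one_left hδΓ0.le (pow_le_one₀ hη0.le hη1.le)
  have hrsucc : ∀ k, r (k + 1) = η₀ * r k := fun k => by simp only [hr, pow_succ]; ring
  have hradd : ∀ k j, r (k + j) = η₀ ^ j * r k := fun k j => by simp only [hr, pow_add]; ring
  have hrmono : ∀ {k l}, k ≤ l → r l ≤ r k := by
    intro k l h
    simp only [hr]
    gcongr ?_ * _
    exact pow_le_pow_of_le_one hη0.le hη1.le h
  choose z hzQ hz1 hz2 hz3 using fun k => hcork xb hxb (r k) (hrpos k) (hrle k)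
  have hzball : ∀ k, z k ∈ Ω ∩ ball xb (r k) := fun k =>
    ⟨(hzQ k).1, by rw [mem_ball, dist_comm]; exact hz2 k⟩
  set Ec : ℝ → ℝ := fun l => ε l ^ (-((n : ℝ) + p) / p) * M ^ (1 / p) with hEc
  have hEc0 : ∀ l, 0 < l → l < 1 → 0 ≤ Ec l := by
    intro l h0 h1
    have := (hconn xb hxb l h0 h1).1
    simp only [hEc]
    positivity
  have hgeo : ∀ β : ℝ, β < (τ₀ - ω₀) / p → ∃ (K : ℝ) (k0 : ℕ), 0 < K ∧
      ∀ l : ℝ, 0 < l → l ≤ η₀ ^ 2 → ∀ k, k0 ≤ k →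
        |gFun Ω u (z k) - gFun Ω u (z (k + 1))| ≤ K * Ec l * r k ^ β ∧
        ∀ x ∈ Ω ∩ ball xb (r k), (l * r k) ^ θ ≤ dB Ω x →
          |gFun Ω u x - gFun Ω u (z k)| ≤ K * Ec l * r k ^ β := by
    intro β hβ
    obtain ⟨K, ρ₂, hK, hρ₂, hest⟩ := hTP β hβ
    obtain ⟨k0, hk0⟩ := exists_pow_lt_of_lt_one (div_pos hρ₂ hδΓ0) hη1
    rw [lt_div_iff₀ hδΓ0] at hk0
    refine ⟨K, k0, hK, ?_⟩
    intro l hl hlη k hk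
    have hl1 : l < 1 := hlη.trans_lt (pow_lt_one₀ hη0.le hη1 (by norm_num))
    have hrk : r k ≤ ρ₂ := (hrmono hk).trans hk0.le
    have hrk0 := hrpos k
    have hlη' : l ≤ η₀ := hlη.trans (by nlinarith)
    have hzk : (l * r k) ^ θ ≤ dB Ω (z k) := by
      refine le_trans ?_ (hz3 k).le
      gcongr
    have hzk1 : (l * r k) ^ θ ≤ dB Ω (z (k + 1)) := by
      refine le_trans ?_ (hz3 (k + 1)).le
      apply Real.rpow_le_rpow (by positivity) _ hθ0
      rw [hrsucc]
      calc l * r k ≤ η₀ ^ 2 * r k := by gcongr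
        _ = _ := by ring
    have hsub : z (k + 1) ∈ Ω ∩ ball xb (r k) :=
      ⟨(hzball (k + 1)).1, ball_subset_ball (hrmono (Nat.le_succ k)) (hzball (k + 1)).2⟩
    exact ⟨hest l hl hl1 (r k) hrk0 hrk _ (hzball k) _ hsub hzk hzk1,
      fun x hx hdx => hest l hl hl1 (r k) hrk0 hrk _ hx _ (hzball k) hdx hzk⟩
  have hη2 : 0 < η₀ ^ 2 := by positivity
  have hη21 : η₀ ^ 2 < 1 := pow_lt_one₀ hη0.le hη1 (by norm_num)
  have hrp : ∀ (β : ℝ) k j, r (k + j) ^ β = r k ^ β * (η₀ ^ β) ^ j := by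
    intro β k j
    have h1 := (hrpos k).le
    rw [hradd, Real.mul_rpow (by positivity) h1, ← Real.rpow_natCast, ← Real.rpow_mul hη0.le,
      mul_comm (j : ℝ) β, Real.rpow_mul hη0.le, Real.rpow_natCast]
    ring
  have hgap : 0 < (τ₀ - ω₀) / p := div_pos (by linarith) hp0
  -- the limit along the corkscrew points
  obtain ⟨L, hL⟩ : ∃ L, Tendsto (fun k => gFun Ω u (z k)) atTop (𝓝 L) := by
    obtain ⟨K, k0, hK, hest⟩ := hgeo ((τ₀ - ω₀) / p / 2) (by linarith)
    set β := (τ₀ - ω₀) / p / 2 with hβ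
    have hc : CauchySeq (fun j => gFun Ω u (z (k0 + j))) := by
      refine cauchySeq_of_le_geometric (η₀ ^ β) (K * Ec (η₀ ^ 2) * r k0 ^ β)
        (Real.rpow_lt_one hη0.le hη1 (by positivity)) ?_
      intro j
      rw [Real.dist_eq]
      refine (hest (η₀ ^ 2) hη2 le_rfl (k0 + j) (Nat.le_add_right _ _)).1.trans ?_
      rw [hrp]
      apply le_of_eq; ring
    obtain ⟨L, hL⟩ := cauchySeq_tendsto_of_complete hc
    refine ⟨L, ?_⟩
    rw [← tendsto_add_atTop_iff_nat k0]
    simpa only [add_comm] using hL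
  have hmain : ∀ β : ℝ, 0 < β → β < (τ₀ - ω₀) / p →
      ∃ δβ : ℝ, 0 < δβ ∧ ∀ lam : ℝ, 0 < lam → lam < 1 →
        ∀ x ∈ Qreg Ω lam θ xb ∩ ball xb δβ,
          |L - gFun Ω u x| ≤ (1 * ε (η₀ ^ 2 * min lam₀ lam) ^ (-((n : ℝ) + p) / p) *
            η₀ ^ (-β) * (1 - η₀ ^ β)⁻¹) * M ^ (1 / p) * dist xb x ^ β := by
    intro β hβ0 hβ1
    set β' := (β + (τ₀ - ω₀) / p) / 2 with hβ'
    have hββ' : β < β' := by rw [hβ']; linarith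
    have hβ'0 : 0 < β' := by linarith
    obtain ⟨K, k0, hK, hest⟩ := hgeo β' (by rw [hβ']; linarith)
    have hηβ' : η₀ ^ β' < 1 := Real.rpow_lt_one hη0.le hη1 hβ'0
    have hηβ : η₀ ^ β < 1 := Real.rpow_lt_one hη0.le hη1 hβ0
    have h1η : 0 < 1 - η₀ ^ β' := by linarith
    set K2 := K * (1 + (1 - η₀ ^ β')⁻¹) * η₀ ^ (-β') with hK2
    have hK2pos : 0 < K2 := by positivity
    refine ⟨min (r k0) (K2⁻¹ ^ (β' - β)⁻¹), lt_min (hrpos k0) (by positivity), ?_⟩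
    rintro lam hlam0 hlam1 x ⟨⟨hxΩ, hxQ⟩, hxball⟩
    set l := η₀ ^ 2 * min lam₀ lam with hl
    have hmin0 : 0 < min lam₀ lam := lt_min hl0 hlam0
    have hmin1 : min lam₀ lam ≤ 1 := (min_le_left _ _).trans hl1.le
    have hlpos : 0 < l := by positivity
    have hlη : l ≤ η₀ ^ 2 := mul_le_of_le_one_right hη2.le hmin1
    have hE := hEc0 l hlpos (hlη.trans_lt hη21)
    rw [mem_ball, dist_comm, lt_min_iff] at hxball
    obtain ⟨hxr, hxK⟩ := hxball
    have hxne : xb ≠ x := by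
      rintro rfl
      have h1 := hΓ hxb
      rw [hΩ.frontier_eq] at h1
      exact h1.2 hxΩ
    have ha : 0 < dist xb x := dist_pos.2 hxne
    set a := dist xb x with hadef
    have hrk0 := hrpos k0
    obtain ⟨j, hj1, hj2⟩ := pow_near hη0 hη1 (div_pos ha hrk0) ((div_lt_one hrk0).2 hxr)
    rw [le_div_iff₀ hrk0] at hj1
    rw [div_lt_iff₀ hrk0, ← hradd] at hj2
    set k := k0 + j with hk
    have hj3 : η₀ * r k ≤ a := by
      rw [hk, hradd]
      calc _ = η₀ ^ (j + 1) * r k0 := by ring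
        _ ≤ _ := hj1
    have hrk := hrpos k
    have hest2 := hest l hlpos hlη k (Nat.le_add_right _ _)
    have hx1 : |gFun Ω u x - gFun Ω u (z k)| ≤ K * Ec l * r k ^ β' := by
      refine hest2.2 x ⟨hxΩ, by rw [mem_ball, dist_comm]; exact hj2⟩ (le_trans ?_ hxQ.le)
      apply Real.rpow_le_rpow (by positivity) _ hθ0
      calc l * r k = η₀ * (min lam₀ lam * (η₀ * r k)) := by rw [hl]; ring
        _ ≤ 1 * (min lam₀ lam * (η₀ * r k)) := by gcongr
        _ = min lam₀ lam * (η₀ * r k) := one_mul _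
        _ ≤ lam * a := by
          gcongr
          exact min_le_right _ _
    have hx2 : |gFun Ω u (z k) - L| ≤ K * Ec l * r k ^ β' * (1 - η₀ ^ β')⁻¹ := by
      have hLk : Tendsto (fun i => gFun Ω u (z (k + i))) atTop (𝓝 L) := by
        have := (tendsto_add_atTop_iff_nat k).2 hL
        simpa only [add_comm] using this
      have := dist_le_of_le_geometric_of_tendsto (η₀ ^ β') (K * Ec l * r k ^ β') hηβ'
        (f := fun i => gFun Ω u (z (k + i))) (fun i => by
          rw [Real.dist_eq]
          refine (hest l hlpos hlη (k + i) (by omega)).1.trans ?_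
          rw [hrp]
          apply le_of_eq; ring) hLk 0
      rw [Real.dist_eq] at this
      simpa [div_eq_mul_inv] using this
    have hrka : r k ^ β' ≤ η₀ ^ (-β') * a ^ β' := by
      rw [Real.rpow_neg hη0.le, ← div_eq_inv_mul, le_div_iff₀ (by positivity), mul_comm,
        ← Real.mul_rpow hη0.le hrk.le]
      gcongr
    have haK : K2 * a ^ (β' - β) ≤ 1 := by
      have h1 : a ^ (β' - β) ≤ (K2⁻¹ ^ (β' - β)⁻¹) ^ (β' - β) :=
        Real.rpow_le_rpow ha.le hxK.le (by linarith)
      rw [Real.rpow_inv_rpow (by positivity) (by linarith)] at h1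
      calc _ ≤ K2 * K2⁻¹ := by gcongr
        _ = 1 := mul_inv_cancel₀ hK2pos.ne'
    have hfac : 1 ≤ η₀ ^ (-β) * (1 - η₀ ^ β)⁻¹ := by
      have h1 : 1 ≤ η₀ ^ (-β) :=
        Real.one_le_rpow_of_pos_of_le_one_of_nonpos hη0 hη1.le (by linarith)
      have h2 : 1 ≤ (1 - η₀ ^ β)⁻¹ :=
        (one_le_inv₀ (by linarith)).2 (by linarith [Real.rpow_pos_of_pos hη0 β])
      nlinarith
    calc |L - gFun Ω u x| = |gFun Ω u x - L| := abs_sub_comm _ _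
      _ ≤ |gFun Ω u x - gFun Ω u (z k)| + |gFun Ω u (z k) - L| := abs_sub_le _ _ _
      _ ≤ K * Ec l * r k ^ β' + K * Ec l * r k ^ β' * (1 - η₀ ^ β')⁻¹ := add_le_add hx1 hx2
      _ = K * (1 + (1 - η₀ ^ β')⁻¹) * Ec l * r k ^ β' := by ring
      _ ≤ K * (1 + (1 - η₀ ^ β')⁻¹) * Ec l * (η₀ ^ (-β') * a ^ β') := by gcongr
      _ = (K2 * a ^ (β' - β)) * (Ec l * a ^ β) := by
          have : a ^ β' = a ^ (β' - β) * a ^ β := by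
            rw [← Real.rpow_add ha]; congr 1; ring
          rw [this, hK2]; ring
      _ ≤ 1 * (Ec l * a ^ β) := by gcongr
      _ ≤ (η₀ ^ (-β) * (1 - η₀ ^ β)⁻¹) * (Ec l * a ^ β) := by gcongr
      _ = _ := by simp only [hEc]; ring
  refine ⟨L, ?_, hmain⟩
  intro lam hlam0 hlam1
  obtain ⟨δβ, hδβ, hb⟩ := hmain ((τ₀ - ω₀) / p / 2) (by linarith) (by linarith)
  set β := (τ₀ - ω₀) / p / 2 with hβ
  set Cc := (1 * ε (η₀ ^ 2 * min lam₀ lam) ^ (-((n : ℝ) + p) / p) *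
            η₀ ^ (-β) * (1 - η₀ ^ β)⁻¹) * M ^ (1 / p) with hCc
  rw [tendsto_iff_dist_tendsto_zero]
  refine squeeze_zero' (g := fun x => Cc * dist xb x ^ β)
    (Eventually.of_forall fun _ => dist_nonneg) ?_ ?_
  · filter_upwards [self_mem_nhdsWithin, mem_nhdsWithin_of_mem_nhds (ball_mem_nhds xb hδβ)]
      with x hx1 hx2
    rw [dist_comm, Real.dist_eq]
    exact hb lam hlam0 hlam1 x ⟨hx1, hx2⟩
  · refine tendsto_nhdsWithin_of_tendsto_nhds ?_
    have hcont : Continuous (fun x => Cc * dist xb x ^ β) := by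
      have h1 : Continuous (fun x : Euc n => dist xb x) := by fun_prop
      exact continuous_const.mul (h1.rpow_const fun _ => Or.inr (by positivity))
    have := hcont.tendsto xb
    simpa [Real.zero_rpow (show β ≠ 0 by positivity)] using this
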